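/- Every element w ∈ G(m,1,n) has a unique expression w = t_{i_1} t_{i_2} ⋯ t_{i_k} with 1 ≤ i_1 < i_2 < ⋯ < i_k ≤ n and t_{i_j} ∈ T_{i_j} for each j; moreover this expression is reduced, i.e. ℓ_R(w) = k. -/

import Mathlib

open Module Set

noncomputable section

variable {V : Type*} [AddCommGroup V] [Module ℂ V]

/-- The codimension of the fixed subspace of a linear automorphism. -/
def fixCodim (w : V ≃ₗ[ℂ] V) : ℕ :=
  finrank ℂ V - finrank ℂ (LinearMap.ker ((w : V →ₗ[ℂ] V) - 1))

/-- A reflection: fixed space has codimension one. -/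
def IsReflection (w : V ≃ₗ[ℂ] V) : Prop := fixCodim w = 1

/-- A finite subgroup of GL(V) generated by its reflections. -/
def IsComplexReflectionGroup (W : Set (V ≃ₗ[ℂ] V)) : Prop :=
  W.Finite ∧ W = (Subgroup.closure {t | t ∈ W ∧ IsReflection t} : Subgroup (V ≃ₗ[ℂ] V))

/-- Reflection length with respect to the reflections of `W`. -/
def reflLen (W : Set (V ≃ₗ[ℂ] V)) (w : V ≃ₗ[ℂ] V) : ℕ :=
  sInf {k | ∃ l : List (V ≃ₗ[ℂ] V), l.length = k ∧
    (∀ t ∈ l, t ∈ W ∧ IsReflection t) ∧ l.prod = w}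

/-- The prefix order relation. -/
def preLe (W : Set (V ≃ₗ[ℂ] V)) (u v : V ≃ₗ[ℂ] V) : Prop :=
  reflLen W u + reflLen W (u⁻¹ * v) = reflLen W v

/-- The codimension order relation. -/
def coLe (u v : V ≃ₗ[ℂ] V) : Prop :=
  fixCodim u + fixCodim (u⁻¹ * v) = fixCodim v

/-- The group `G(m,p,n)` of monomial matrices with `m`-th root of unity entries whose
product is an `(m/p)`-th root of unity, as linear automorphisms of `ℂⁿ`. -/
def Gmpn (m p n : ℕ) : Set ((Fin n → ℂ) ≃ₗ[ℂ] (Fin n → ℂ)) :=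
  {w | ∃ (σ : Equiv.Perm (Fin n)) (a : Fin n → ℂ),
    (∀ i, a i ^ m = 1) ∧ (∏ i, a i) ^ (m / p) = 1 ∧
    ∀ j, w (Pi.single j (1 : ℂ)) = a j • (Pi.single (σ j) (1 : ℂ) : Fin n → ℂ)}

section Poset

variable {α : Type*}

/-- An antichain of the poset on carrier `P` with order relation `le`. -/
def IsAntichainOn (P : Set α) (le : α → α → Prop) (A : Set α) : Prop :=
  A ⊆ P ∧ ∀ x ∈ A, ∀ y ∈ A, x ≠ y → ¬ le x y ∧ ¬ le y x

/-- `k`-Sperner: no union of `k` antichains is larger than the union of some `k` ranks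
(equivalently, of the `k` largest ranks). -/
def IsKSpernerOn (P : Set α) (le : α → α → Prop) (rk : α → ℕ) (k : ℕ) : Prop :=
  ∀ 𝒜 : Fin k → Set α, (∀ i, IsAntichainOn P le (𝒜 i)) →
    ∃ S : Finset ℕ, S.card ≤ k ∧ (⋃ i, 𝒜 i).ncard ≤ {x | x ∈ P ∧ rk x ∈ S}.ncard

def IsStronglySpernerOn (P : Set α) (le : α → α → Prop) (rk : α → ℕ) : Prop :=
  ∀ k, IsKSpernerOn P le rk k

/-- Sperner: no antichain is larger than some (equivalently, the largest) rank. -/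
def IsSpernerOn (P : Set α) (le : α → α → Prop) (rk : α → ℕ) : Prop :=
  ∀ A : Set α, IsAntichainOn P le A → ∃ i, A.ncard ≤ {x | x ∈ P ∧ rk x = i}.ncard

/-- Covering relation of the poset on carrier `P`. -/
def CoversOn (P : Set α) (le : α → α → Prop) (x y : α) : Prop :=
  x ∈ P ∧ y ∈ P ∧ le x y ∧ x ≠ y ∧ ∀ z ∈ P, le x z → le z y → z = x ∨ z = y

/-- A normalized flow on the bipartite graph with parts `A`, `B`, edge relation `E`
and vertex weights `ν`. -/
def IsNormalizedFlowBetween (A B : Set α) (E : α → α → Prop) (ν : α → ℝ)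
    (f : α → α → ℝ) : Prop :=
  (∀ a b, 0 ≤ f a b) ∧
  (∀ a b, f a b ≠ 0 → a ∈ A ∧ b ∈ B ∧ E a b) ∧
  (∀ a ∈ A, (∑ᶠ b ∈ B, f a b) = ν a / ∑ᶠ x ∈ A, ν x) ∧
  (∀ b ∈ B, (∑ᶠ a ∈ A, f a b) = ν b / ∑ᶠ x ∈ B, ν x)

/-- A ranked poset has a normalized flow if each bipartite graph of covering relations
between consecutive ranks admits one. -/
def HasNormalizedFlowOn (P : Set α) (le : α → α → Prop) (rk : α → ℕ) (ν : α → ℝ) : Prop :=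
  ∀ i : ℕ, ∃ f, IsNormalizedFlowBetween {x | x ∈ P ∧ rk x = i} {x | x ∈ P ∧ rk x = i + 1}
    (CoversOn P le) ν f

end Poset


/-- `t` moves the `k`-th coordinate line. -/
def movesCoord {n : ℕ} (t : (Fin n → ℂ) ≃ₗ[ℂ] (Fin n → ℂ)) (k : Fin n) : Prop :=
  t (Pi.single k (1 : ℂ)) ≠ (Pi.single k (1 : ℂ) : Fin n → ℂ)

/-- The set `T_j` of reflections of `G(m,1,n)` whose largest moved coordinate is `j`:
these are exactly the type (1) reflections `[a | (i,j)]` with `i < j` together with the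
type (2) reflections which are nontrivial precisely in coordinate `j`. -/
def Tset (m n : ℕ) (j : Fin n) : Set ((Fin n → ℂ) ≃ₗ[ℂ] (Fin n → ℂ)) :=
  {t | t ∈ Gmpn m 1 n ∧ IsReflection t ∧ movesCoord t j ∧ ∀ k, movesCoord t k → k ≤ j}

/-- The fixed subspace of a linear automorphism. -/
def fixSub (w : V ≃ₗ[ℂ] V) : Submodule ℂ V := LinearMap.ker ((w : V →ₗ[ℂ] V) - 1)

lemma mem_fixSub {w : V ≃ₗ[ℂ] V} {x : V} : x ∈ fixSub w ↔ w x = x := by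
  simp [fixSub, LinearMap.mem_ker, sub_eq_zero]

lemma apply_inv_apply (w : V ≃ₗ[ℂ] V) (x : V) : w (w⁻¹ x) = x := by
  rw [← LinearEquiv.mul_apply, mul_inv_cancel]
  rfl

lemma inv_apply_apply (w : V ≃ₗ[ℂ] V) (x : V) : w⁻¹ (w x) = x := by
  rw [← LinearEquiv.mul_apply, inv_mul_cancel]
  rfl

lemma fixCodim_eq_finrank_range [FiniteDimensional ℂ V] (w : V ≃ₗ[ℂ] V) :
    fixCodim w = finrank ℂ (LinearMap.range ((w : V →ₗ[ℂ] V) - 1)) := by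
  have h := LinearMap.finrank_range_add_finrank_ker ((w : V →ₗ[ℂ] V) - 1)
  unfold fixCodim
  omega

lemma IsReflection.exists_eq_add_smul [FiniteDimensional ℂ V] {s : V ≃ₗ[ℂ] V}
    (hs : IsReflection s) {y : V} (hy : s y - y ≠ 0) (x : V) :
    ∃ c : ℂ, s x = x + c • (s y - y) := by
  unfold IsReflection at hs
  rw [fixCodim_eq_finrank_range] at hs
  have hmem : ∀ z, s z - z ∈ LinearMap.range ((s : V →ₗ[ℂ] V) - 1) := fun z => ⟨z, by simp⟩
  obtain ⟨c, hc⟩ := (finrank_eq_one_iff_of_nonzero'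
    (⟨s y - y, hmem y⟩ : LinearMap.range ((s : V →ₗ[ℂ] V) - 1))
    (by simpa [Subtype.ext_iff] using hy)).1 hs ⟨s x - x, hmem x⟩
  have h : c • (s y - y) = s x - x := congrArg Subtype.val hc
  exact ⟨c, by rw [h]; abel⟩

lemma isReflection_of_range_le [FiniteDimensional ℂ V] {s : V ≃ₗ[ℂ] V} {r y : V}
    (h : LinearMap.range ((s : V →ₗ[ℂ] V) - 1) ≤ Submodule.span ℂ {r}) (hy : s y ≠ y) :
    IsReflection s := by
  unfold IsReflection
  rw [fixCodim_eq_finrank_range]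
  apply le_antisymm
  · exact (Submodule.finrank_mono h).trans ((finrank_span_le_card _).trans (by simp))
  · rw [Nat.one_le_iff_ne_zero]
    intro h0
    rw [Submodule.finrank_eq_zero] at h0
    have hm : s y - y ∈ LinearMap.range ((s : V →ₗ[ℂ] V) - 1) := ⟨y, by simp⟩
    rw [h0, Submodule.mem_bot, sub_eq_zero] at hm
    exact hy hm

lemma finrank_le_finrank_fixSub_prod_add_length [FiniteDimensional ℂ V]
    (l : List (V ≃ₗ[ℂ] V)) (hl : ∀ t ∈ l, IsReflection t) :
    finrank ℂ V ≤ finrank ℂ (fixSub l.prod) + l.length := by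
  induction l with
  | nil =>
    have : fixSub (1 : V ≃ₗ[ℂ] V) = ⊤ := by
      ext x; simp [mem_fixSub]
    rw [List.prod_nil, this, finrank_top]
    simp
  | cons t l ih =>
    have h1 := ih fun s hs => hl s (List.mem_cons_of_mem _ hs)
    have h2 : IsReflection t := hl t List.mem_cons_self
    have h3 := Submodule.finrank_sup_add_finrank_inf_eq (fixSub t) (fixSub l.prod)
    have h4 := Submodule.finrank_le (fixSub t ⊔ fixSub l.prod)
    have h5 : finrank ℂ V - finrank ℂ (fixSub t) = 1 := h2
    have h6 : finrank ℂ (fixSub t ⊓ fixSub l.prod : Submodule ℂ V)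
        ≤ finrank ℂ (fixSub (t * l.prod)) := by
      apply Submodule.finrank_mono
      rintro x ⟨hx1, hx2⟩
      rw [SetLike.mem_coe, mem_fixSub] at hx1 hx2
      rw [mem_fixSub, LinearEquiv.mul_apply, hx2, hx1]
    rw [List.prod_cons, List.length_cons]
    omega

/-- The coordinate vectors of `ℂⁿ`. -/
abbrev coordVec {n : ℕ} (k : Fin n) : Fin n → ℂ := Pi.single k 1

lemma linearEquiv_ext_coordVec {n : ℕ} {s t : (Fin n → ℂ) ≃ₗ[ℂ] (Fin n → ℂ)}
    (h : ∀ k, s (coordVec k) = t (coordVec k)) : s = t := by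
  apply LinearEquiv.toLinearMap_injective
  refine (Pi.basisFun ℂ (Fin n)).ext fun k => ?_
  simpa using h k

lemma mem_Gmpn_one {m n : ℕ} {w : (Fin n → ℂ) ≃ₗ[ℂ] (Fin n → ℂ)} :
    w ∈ Gmpn m 1 n ↔ ∃ (σ : Equiv.Perm (Fin n)) (a : Fin n → ℂ), (∀ i, a i ^ m = 1) ∧
      ∀ j, w (coordVec j) = a j • coordVec (σ j) := by
  constructor
  · rintro ⟨σ, a, h1, -, h2⟩
    exact ⟨σ, a, h1, h2⟩
  · rintro ⟨σ, a, h1, h2⟩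
    refine ⟨σ, a, h1, ?_, h2⟩
    rw [Nat.div_one, ← Finset.prod_pow]
    exact Finset.prod_eq_one fun i _ => h1 i

lemma mul_mem_Gmpn_one {m n : ℕ} {v w : (Fin n → ℂ) ≃ₗ[ℂ] (Fin n → ℂ)}
    (hv : v ∈ Gmpn m 1 n) (hw : w ∈ Gmpn m 1 n) : v * w ∈ Gmpn m 1 n := by
  obtain ⟨σ, a, ha, hσ⟩ := mem_Gmpn_one.1 hv
  obtain ⟨τ, b, hb, hτ⟩ := mem_Gmpn_one.1 hw
  refine mem_Gmpn_one.2 ⟨σ * τ, fun j => b j * a (τ j), fun i => ?_, fun j => ?_⟩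
  · simp [mul_pow, ha, hb]
  · rw [LinearEquiv.mul_apply, hτ, map_smul, hσ, smul_smul, Equiv.Perm.mul_apply]

lemma ne_zero_of_pow_eq_one_of_one_le {m : ℕ} (hm : 1 ≤ m) {c : ℂ} (hc : c ^ m = 1) : c ≠ 0 := by
  rintro rfl
  rw [zero_pow (by omega)] at hc
  exact zero_ne_one hc

lemma inv_mem_Gmpn_one {m n : ℕ} (hm : 1 ≤ m) {w : (Fin n → ℂ) ≃ₗ[ℂ] (Fin n → ℂ)}
    (hw : w ∈ Gmpn m 1 n) : w⁻¹ ∈ Gmpn m 1 n := by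
  obtain ⟨σ, a, ha, hσ⟩ := mem_Gmpn_one.1 hw
  refine mem_Gmpn_one.2 ⟨σ⁻¹, fun j => (a (σ⁻¹ j))⁻¹, fun i => by simp [ha], fun j => ?_⟩
  apply w.injective
  rw [apply_inv_apply, map_smul, hσ, smul_smul,
    inv_mul_cancel₀ (ne_zero_of_pow_eq_one_of_one_le hm (ha _)), one_smul]
  simp

lemma one_mem_Gmpn_one {m n : ℕ} : (1 : (Fin n → ℂ) ≃ₗ[ℂ] (Fin n → ℂ)) ∈ Gmpn m 1 n :=
  mem_Gmpn_one.2 ⟨1, fun _ => 1, by simp, by simp⟩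

/-- A reflection of `G(m,1,n)` carrying `c • v_i` to `v_j` agrees on coordinate vectors with an
explicit monomial map. -/
lemma IsReflection.apply_coordVec {m n : ℕ} {s : (Fin n → ℂ) ≃ₗ[ℂ] (Fin n → ℂ)}
    (hs : s ∈ Gmpn m 1 n) (hr : IsReflection s) {c : ℂ} (hc0 : c ≠ 0) {i j : Fin n}
    (hs1 : s (c • coordVec i) = coordVec j) (hne : c • coordVec i ≠ coordVec j) (k : Fin n) :
    s (coordVec k) = if k = i then c⁻¹ • coordVec j else if k = j then c • coordVec i
      else coordVec k := by
  have hi : s (coordVec i) = c⁻¹ • coordVec j := by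
    rw [← hs1, map_smul, smul_smul, inv_mul_cancel₀ hc0, one_smul]
  obtain ⟨σ, a, -, hσ⟩ := mem_Gmpn_one.1 hs
  have key : ∀ x, ∃ d : ℂ, s x = x + d • (coordVec j - c • coordVec i) := fun x => by
    have := hr.exists_eq_add_smul (y := c • coordVec i) (by rw [hs1, sub_ne_zero]; exact hne.symm) x
    rwa [hs1] at this
  have hfix : ∀ k, k ≠ i → k ≠ j → s (coordVec k) = coordVec k := fun k hki hkj => by
    obtain ⟨d, hd⟩ := key (coordVec k)
    have h := congrFun hd k
    rw [hσ] at h ⊢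
    simp only [Pi.smul_apply, Pi.add_apply, Pi.sub_apply, Pi.single_apply, hki, hkj,
      smul_eq_mul] at h
    by_cases hk : k = σ k
    · rw [← hk] at h ⊢
      simp at h
      rw [h, one_smul]
    · simp [hk] at h
  split_ifs with h1 h2
  · rw [h1, hi]
  · subst h2
    have hσi : σ i = k := by
      by_contra hcon
      have h := congrFun hi k
      rw [hσ] at h
      simp [Ne.symm hcon] at h
      exact hc0 h.symm
    have hσk : σ k ≠ k := fun h => h1 (σ.injective (h.trans hσi.symm))
    obtain ⟨d, hd⟩ := key (coordVec k)
    have h := congrFun hd k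
    rw [hσ] at h
    simp [hσk.symm, h1] at h
    rw [hd, show d = -1 by linear_combination -h]
    simp
  · exact hfix k h1 h2

/-- The linear automorphism with the given monomial matrix. -/
def monomialEquiv {n : ℕ} (σ : Equiv.Perm (Fin n)) (a : Fin n → ℂˣ) :
    (Fin n → ℂ) ≃ₗ[ℂ] (Fin n → ℂ) :=
  (LinearEquiv.piCongrRight fun i => LinearEquiv.smulOfUnit (a i)) ≪≫ₗ
    LinearEquiv.funCongrLeft ℂ ℂ σ.symm

lemma monomialEquiv_apply_coordVec {n : ℕ} (σ : Equiv.Perm (Fin n)) (a : Fin n → ℂˣ)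
    (k : Fin n) : monomialEquiv σ a (coordVec k) = (a k : ℂ) • coordVec (σ k) := by
  ext l
  by_cases h : l = σ k
  · subst h
    simp only [monomialEquiv, LinearEquiv.trans_apply, LinearEquiv.funCongrLeft_apply,
      LinearMap.funLeft_apply, Equiv.symm_apply_apply, LinearEquiv.piCongrRight_apply,
      Pi.single_eq_same, Pi.smul_apply, smul_eq_mul]
    rfl
  · have h' : σ.symm l ≠ k := fun h' => h (by simp [← h'])
    simp [monomialEquiv, LinearEquiv.funCongrLeft_apply, LinearMap.funLeft_apply, h, h']

lemma exists_reflection_of_ne {m n : ℕ} (hm : 1 ≤ m) {c : ℂ} (hc : c ^ m = 1) {i j : Fin n}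
    (hne : c • coordVec i ≠ coordVec j) :
    ∃ s ∈ Gmpn m 1 n, IsReflection s ∧ s (c • coordVec i) = coordVec j ∧
      ∀ k, k ≠ i → k ≠ j → s (coordVec k) = coordVec k := by
  have hc0 := ne_zero_of_pow_eq_one_of_one_le hm hc
  let u : ℂˣ := Units.mk0 c hc0
  let s := monomialEquiv (Equiv.swap i j) (fun k => if k = i then u⁻¹ else if k = j then u else 1)
  have hs : ∀ k, s (coordVec k) = _ := monomialEquiv_apply_coordVec _ _
  have h1 : s (c • coordVec i) = coordVec j := by
    rw [map_smul, hs]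
    simp [u, smul_smul, hc0]
  have h2 : ∀ k, k ≠ i → k ≠ j → s (coordVec k) = coordVec k := fun k hki hkj => by
    rw [hs, Equiv.swap_apply_of_ne_of_ne hki hkj]
    simp [hki, hkj]
  refine ⟨s, mem_Gmpn_one.2 ⟨_, _, fun k => ?_, hs⟩, ?_, h1, h2⟩
  · split_ifs <;> simp [u, hc]
  · refine isReflection_of_range_le (r := coordVec j - c • coordVec i) (y := c • coordVec i) ?_
      (by rw [h1]; exact hne.symm)
    rw [LinearMap.range_eq_map, ← (Pi.basisFun ℂ (Fin n)).span_eq, Submodule.map_span,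
      Submodule.span_le]
    rintro _ ⟨_, ⟨k, rfl⟩, rfl⟩
    rw [SetLike.mem_coe, Submodule.mem_span_singleton]
    have hsi : s (coordVec i) = c⁻¹ • coordVec j := by
      rw [← h1, map_smul, smul_smul, inv_mul_cancel₀ hc0, one_smul]
    by_cases hki : k = i
    · subst hki
      refine ⟨c⁻¹, ?_⟩
      simp [hsi, smul_sub, smul_smul, hc0]
    by_cases hkj : k = j
    · subst hkj
      refine ⟨-1, ?_⟩
      simp [hs, hki, u]
    · exact ⟨0, by simp [h2 k hki hkj]⟩

section Factorization

variable {m n : ℕ}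

lemma apply_coordVec_of_lt {t : (Fin n → ℂ) ≃ₗ[ℂ] (Fin n → ℂ)} {j l : Fin n}
    (ht : t = 1 ∨ t ∈ Tset m n j) (hl : j < l) : t (coordVec l) = coordVec l := by
  rcases ht with rfl | ⟨-, -, -, h⟩
  · rfl
  · by_contra hcon
    exact absurd (h l hcon) (not_le.2 hl)

lemma apply_eq_of_coord_eq {s : (Fin n → ℂ) ≃ₗ[ℂ] (Fin n → ℂ)} {j : Fin n}
    (hs : s ∈ Tset m n j) {x : Fin n → ℂ} (hx : s x j = x j) : s x = x := by
  obtain ⟨hG, hr, hmv, -⟩ := hs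
  obtain ⟨σ, a, -, hσ⟩ := mem_Gmpn_one.1 hG
  obtain ⟨d, hd⟩ := hr.exists_eq_add_smul (y := coordVec j) (sub_ne_zero.2 hmv) x
  have hj : (s (coordVec j) - coordVec j) j ≠ 0 := by
    rw [hσ]
    by_cases h : σ j = j
    · intro h0
      rw [h] at h0
      simp [sub_eq_zero] at h0
      exact hmv ((hσ j).trans (by rw [h, h0, one_smul]))
    · simp [Ne.symm h]
  have h := congrFun hd j
  rw [hx, Pi.add_apply, Pi.smul_apply, smul_eq_mul, left_eq_add, mul_eq_zero] at h
  rw [hd, h.resolve_right hj, zero_smul, add_zero]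

lemma eq_of_inv_apply_eq (hm : 1 ≤ m) {s t : (Fin n → ℂ) ≃ₗ[ℂ] (Fin n → ℂ)} {j : Fin n}
    (hs : s = 1 ∨ s ∈ Tset m n j) (ht : t = 1 ∨ t ∈ Tset m n j)
    (h : s⁻¹ (coordVec j) = t⁻¹ (coordVec j)) : s = t := by
  have hinv : ∀ r : (Fin n → ℂ) ≃ₗ[ℂ] (Fin n → ℂ), r (r⁻¹ (coordVec j)) = coordVec j :=
    fun r => apply_inv_apply r _
  have hne : ∀ r ∈ Tset m n j, r⁻¹ (coordVec j) ≠ coordVec j := fun r hr h => by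
    have := hinv r
    rw [h] at this
    exact hr.2.2.1 this
  rcases hs with rfl | hs
  · rcases ht with rfl | ht
    · rfl
    · exact absurd h.symm (hne t ht)
  · rcases ht with rfl | ht
    · exact absurd h (hne s hs)
    · obtain ⟨σ, a, ha, hσ⟩ := mem_Gmpn_one.1 (inv_mem_Gmpn_one hm hs.1)
      have ha0 := ne_zero_of_pow_eq_one_of_one_le hm (ha j)
      have hs1 := hinv s
      have ht1 := hinv t
      have hsn := hne s hs
      rw [← h] at ht1
      rw [hσ] at hs1 ht1 hsn
      refine linearEquiv_ext_coordVec fun k => ?_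
      rw [hs.2.1.apply_coordVec hs.1 ha0 hs1 hsn, ht.2.1.apply_coordVec ht.1 ha0 ht1 hsn]

/-- The product of the first `k` entries of a tuple. -/
def partialProd {G : Type*} [Monoid G] (t : Fin n → G) (k : ℕ) : G :=
  ((List.ofFn t).take k).prod

lemma partialProd_zero {G : Type*} [Monoid G] (t : Fin n → G) : partialProd t 0 = 1 := by
  simp [partialProd]

lemma partialProd_succ {G : Type*} [Monoid G] (t : Fin n → G) {k : ℕ} (hk : k < n) :
    partialProd t (k + 1) = partialProd t k * t ⟨k, hk⟩ := by
  unfold partialProd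
  rw [List.prod_take_succ _ _ (by simpa using hk), List.getElem_ofFn]

lemma partialProd_self {G : Type*} [Monoid G] (t : Fin n → G) :
    partialProd t n = (List.ofFn t).prod := by
  rw [partialProd, List.take_of_length_le (by simp)]

lemma partialProd_congr {G : Type*} [Monoid G] {t t' : Fin n → G} {k : ℕ} (hk : k ≤ n)
    (h : ∀ i : Fin n, i.1 < k → t i = t' i) : partialProd t k = partialProd t' k := by
  induction k with
  | zero => simp [partialProd_zero]
  | succ k ih =>
    rw [partialProd_succ t hk, partialProd_succ t' hk, h ⟨k, hk⟩ (Nat.lt_succ_self k),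
      ih (by omega) fun i hi => h i (by omega)]

lemma partialProd_apply_coordVec {t : Fin n → ((Fin n → ℂ) ≃ₗ[ℂ] (Fin n → ℂ))}
    (ht : ∀ j, t j = 1 ∨ t j ∈ Tset m n j) {k : ℕ} (hk : k ≤ n) {l : Fin n} (hl : k ≤ l.1) :
    partialProd t k (coordVec l) = coordVec l := by
  induction k with
  | zero => simp [partialProd_zero]
  | succ k ih =>
    rw [partialProd_succ t hk, LinearEquiv.mul_apply,
      apply_coordVec_of_lt (ht ⟨k, hk⟩) (Fin.lt_def.2 hl), ih (by omega) (by omega)]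

lemma eq_of_partialProd_eq (hm : 1 ≤ m) {t t' : Fin n → ((Fin n → ℂ) ≃ₗ[ℂ] (Fin n → ℂ))}
    (ht : ∀ j, t j = 1 ∨ t j ∈ Tset m n j) (ht' : ∀ j, t' j = 1 ∨ t' j ∈ Tset m n j)
    {k : ℕ} (hk : k ≤ n) (h : partialProd t k = partialProd t' k) :
    ∀ i : Fin n, i.1 < k → t i = t' i := by
  induction k with
  | zero => exact fun i hi => absurd hi (Nat.not_lt_zero _)
  | succ k ih =>
    rw [partialProd_succ t hk, partialProd_succ t' hk] at h
    have hinv : ∀ r : Fin n → ((Fin n → ℂ) ≃ₗ[ℂ] (Fin n → ℂ)),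
        (∀ j, r j = 1 ∨ r j ∈ Tset m n j) →
        (partialProd r k * r ⟨k, hk⟩)⁻¹ (coordVec ⟨k, hk⟩) = (r ⟨k, hk⟩)⁻¹ (coordVec ⟨k, hk⟩) := by
      intro r hr
      have h1 := partialProd_apply_coordVec hr (l := ⟨k, hk⟩) (by omega : k ≤ n) le_rfl
      conv_lhs => rw [← h1]
      rw [← LinearEquiv.mul_apply]
      congr 1
      group
    have hlast : t ⟨k, hk⟩ = t' ⟨k, hk⟩ :=
      eq_of_inv_apply_eq hm (ht _) (ht' _) (by rw [← hinv t ht, h, hinv t' ht'])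
    rw [hlast, mul_left_inj] at h
    intro i hi
    rcases Nat.lt_succ_iff_lt_or_eq.1 hi with hi | hi
    · exact ih (by omega) h i hi
    · obtain rfl : i = ⟨k, hk⟩ := Fin.ext hi
      exact hlast

lemma exists_partialProd_eq (hm : 1 ≤ m) {k : ℕ} (hk : k ≤ n)
    {w : (Fin n → ℂ) ≃ₗ[ℂ] (Fin n → ℂ)} (hw : w ∈ Gmpn m 1 n)
    (hfix : ∀ l : Fin n, k ≤ l.1 → w (coordVec l) = coordVec l) :
    ∃ t : Fin n → ((Fin n → ℂ) ≃ₗ[ℂ] (Fin n → ℂ)),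
      (∀ j, t j = 1 ∨ t j ∈ Tset m n j) ∧ partialProd t k = w := by
  induction k generalizing w with
  | zero =>
    refine ⟨fun _ => 1, fun _ => Or.inl rfl, ?_⟩
    rw [partialProd_zero]
    exact linearEquiv_ext_coordVec fun l => (hfix l (Nat.zero_le _)).symm
  | succ k ih =>
    let j : Fin n := ⟨k, hk⟩
    obtain ⟨s, hsG, hsT, hsw, hsfix⟩ : ∃ s ∈ Gmpn m 1 n, (s = 1 ∨ s ∈ Tset m n j) ∧
        s⁻¹ (coordVec j) = w⁻¹ (coordVec j) ∧
        ∀ l : Fin n, j < l → s (coordVec l) = coordVec l := by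
      by_cases hwj : w⁻¹ (coordVec j) = coordVec j
      · exact ⟨1, one_mem_Gmpn_one, Or.inl rfl, by simp [hwj], by simp⟩
      obtain ⟨σ, a, ha, hσ⟩ := mem_Gmpn_one.1 (inv_mem_Gmpn_one hm hw)
      have ha0 := ne_zero_of_pow_eq_one_of_one_le hm (ha j)
      rw [hσ] at hwj
      have hle : σ j ≤ j := by
        by_contra! hlt
        have h1 := apply_inv_apply w (coordVec j)
        rw [hσ, map_smul, hfix _ (Fin.lt_def.1 hlt)] at h1
        have h2 := congrFun h1 j
        simp [hlt.ne] at h2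
      obtain ⟨s, hsG, hsr, hs1, hs2⟩ := exists_reflection_of_ne hm (ha j) hwj
      have hs3 : ∀ l : Fin n, j < l → s (coordVec l) = coordVec l := fun l hl =>
        hs2 l (hle.trans_lt hl).ne' hl.ne'
      refine ⟨s, hsG, Or.inr ⟨hsG, hsr, fun hcon => hwj ?_, fun l hl => ?_⟩, ?_, hs3⟩
      · exact s.injective (hs1.trans hcon.symm)
      · by_contra! hlt
        exact hl (hs3 l hlt)
      · rw [hσ, ← hs1, inv_apply_apply]
    obtain ⟨t, ht, htw⟩ := ih (by omega) (w := w * s⁻¹)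
      (mul_mem_Gmpn_one hw (inv_mem_Gmpn_one hm hsG)) (fun l hl => by
        rw [LinearEquiv.mul_apply]
        rcases hl.eq_or_lt with hl | hl
        · obtain rfl : l = j := Fin.ext hl.symm
          rw [hsw, apply_inv_apply]
        · have h1 : s⁻¹ (coordVec l) = coordVec l := by
            apply s.injective
            rw [apply_inv_apply,
              hsfix l (Fin.lt_def.2 hl)]
          rw [h1, hfix l hl])
    refine ⟨Function.update t j s, fun i => ?_, ?_⟩
    · by_cases hi : i = j
      · subst hi
        simpa using hsT
      · simpa [hi] using ht i
    · rw [partialProd_succ _ hk, Function.update_self,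
        partialProd_congr (t' := t) (by omega) fun i hi => Function.update_of_ne
          (fun hij => by rw [hij] at hi; exact lt_irrefl _ hi) _ _, htw, inv_mul_cancel_right]

lemma coord_apply_of_apply_coordVec {w : (Fin n → ℂ) ≃ₗ[ℂ] (Fin n → ℂ)} (hw : w ∈ Gmpn m 1 n)
    {j : Fin n} (hj : w (coordVec j) = coordVec j) (x : Fin n → ℂ) : w x j = x j := by
  obtain ⟨σ, a, -, hσ⟩ := mem_Gmpn_one.1 hw
  have hσj : σ j = j := by
    by_contra hcon
    have h := congrFun hj j
    rw [hσ] at h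
    simp [Ne.symm hcon] at h
  have h : LinearMap.proj j ∘ₗ (w : (Fin n → ℂ) →ₗ[ℂ] (Fin n → ℂ)) = LinearMap.proj j := by
    refine (Pi.basisFun ℂ (Fin n)).ext fun k => ?_
    by_cases hk : k = j
    · subst hk
      simp [hj]
    · have hk' : σ k ≠ j := fun h => hk (σ.injective (h.trans hσj.symm))
      simp [hσ, Ne.symm hk, hk'.symm]
  exact LinearMap.congr_fun h x

lemma partialProd_mem_Gmpn_one {t : Fin n → ((Fin n → ℂ) ≃ₗ[ℂ] (Fin n → ℂ))}
    (ht : ∀ j, t j = 1 ∨ t j ∈ Tset m n j) {k : ℕ} (hk : k ≤ n) :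
    partialProd t k ∈ Gmpn m 1 n := by
  induction k with
  | zero => rw [partialProd_zero]; exact one_mem_Gmpn_one
  | succ k ih =>
    rw [partialProd_succ t hk]
    refine mul_mem_Gmpn_one (ih (by omega)) ?_
    rcases ht ⟨k, hk⟩ with h | h
    · rw [h]; exact one_mem_Gmpn_one
    · exact h.1

lemma exists_reflection_list {t : Fin n → ((Fin n → ℂ) ≃ₗ[ℂ] (Fin n → ℂ))}
    (ht : ∀ j, t j = 1 ∨ t j ∈ Tset m n j) {k : ℕ} (hk : k ≤ n) :
    ∃ l : List ((Fin n → ℂ) ≃ₗ[ℂ] (Fin n → ℂ)), l.length = {j : Fin n | j.1 < k ∧ t j ≠ 1}.ncard ∧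
      (∀ s ∈ l, s ∈ Gmpn m 1 n ∧ IsReflection s) ∧ l.prod = partialProd t k ∧
      l.length + finrank ℂ (fixSub (partialProd t k)) ≤ n := by
  induction k with
  | zero =>
    refine ⟨[], by simp, by simp, by simp [partialProd_zero], ?_⟩
    simpa using Submodule.finrank_le (fixSub (partialProd t 0))
  | succ k ih =>
    obtain ⟨l, hl1, hl2, hl3, hl4⟩ := ih (by omega)
    let j : Fin n := ⟨k, hk⟩
    rw [partialProd_succ t hk]
    by_cases h1 : t j = 1
    · have hset : {i : Fin n | i.1 < k + 1 ∧ t i ≠ 1} = {i : Fin n | i.1 < k ∧ t i ≠ 1} := by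
        ext i
        refine ⟨fun h => ⟨?_, h.2⟩, fun h => ⟨by have := h.1; omega, h.2⟩⟩
        refine lt_of_le_of_ne (Nat.lt_succ_iff.1 h.1) fun hik => h.2 ?_
        rwa [show i = j from Fin.ext hik]
      rw [hset, show t ⟨k, hk⟩ = 1 from h1, mul_one]
      exact ⟨l, hl1, hl2, hl3, hl4⟩
    · have hT := (ht j).resolve_left h1
      have hset : {i : Fin n | i.1 < k + 1 ∧ t i ≠ 1} =
          insert j {i : Fin n | i.1 < k ∧ t i ≠ 1} := by
        ext i
        constructor
        · rintro ⟨hi, hti⟩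
          rcases Nat.lt_succ_iff_lt_or_eq.1 hi with hi | hi
          · exact Or.inr ⟨hi, hti⟩
          · exact Or.inl (Fin.ext hi)
        · rintro (rfl | ⟨hi, hti⟩)
          · exact ⟨Nat.lt_succ_self k, h1⟩
          · exact ⟨by omega, hti⟩
      have hlt : fixSub (partialProd t k * t j) < fixSub (partialProd t k) := by
        have hPj : partialProd t k (coordVec j) = coordVec j :=
          partialProd_apply_coordVec ht (by omega) le_rfl
        have hfix : ∀ x, (partialProd t k * t j) x = x → t j x = x := fun x hx =>
          apply_eq_of_coord_eq hT <| by
            rw [← coord_apply_of_apply_coordVec (partialProd_mem_Gmpn_one ht (by omega)) hPj (t j x),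
              ← LinearEquiv.mul_apply, hx]
        refine lt_of_le_of_ne (fun x hx => ?_) fun heq => ?_
        · rw [mem_fixSub] at hx ⊢
          rw [LinearEquiv.mul_apply, hfix x hx] at hx
          exact hx
        · rw [← mem_fixSub, ← heq, mem_fixSub] at hPj
          exact hT.2.2.1 (hfix _ hPj)
      refine ⟨l ++ [t j], ?_, ?_, ?_, ?_⟩
      · rw [hset, ncard_insert_of_notMem (fun h => lt_irrefl _ h.1), List.length_append, hl1]
        rfl
      · intro s hs
        rcases List.mem_append.1 hs with hs | hs
        · exact hl2 s hs
        · rw [List.mem_singleton.1 hs]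
          exact ⟨hT.1, hT.2.1⟩
      · rw [List.prod_append, List.prod_singleton, hl3]
      · have := Submodule.finrank_lt_finrank_of_lt hlt
        rw [List.length_append, List.length_singleton]
        change _ + finrank ℂ (fixSub (partialProd t k * t j)) ≤ n
        omega

end Factorization

/-- Every element of `G(m,1,n)` is uniquely a product `t_{i_1} ⋯ t_{i_k}` with
`i_1 < ⋯ < i_k` and `t_{i_j} ∈ T_{i_j}`, and this expression is reduced. -/
theorem statement4 (m n : ℕ) (hm : 1 ≤ m) (hn : 1 ≤ n) :
    ∀ w ∈ Gmpn m 1 n,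
      (∃! t : Fin n → ((Fin n → ℂ) ≃ₗ[ℂ] (Fin n → ℂ)),
        (∀ j, t j = 1 ∨ t j ∈ Tset m n j) ∧ (List.ofFn t).prod = w) ∧
      (∀ t : Fin n → ((Fin n → ℂ) ≃ₗ[ℂ] (Fin n → ℂ)),
        (∀ j, t j = 1 ∨ t j ∈ Tset m n j) → (List.ofFn t).prod = w →
        reflLen (Gmpn m 1 n) w = {j | t j ≠ 1}.ncard) := by
  intro w hw
  refine ⟨?_, fun t ht htw => ?_⟩
  · obtain ⟨t, ht, htw⟩ := exists_partialProd_eq hm le_rfl hw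
      fun l hl => absurd l.2 (not_lt.2 hl)
    refine ⟨t, ⟨ht, by rw [← partialProd_self, htw]⟩, fun t' ⟨ht', htw'⟩ => ?_⟩
    rw [← partialProd_self, ← htw] at htw'
    exact funext fun i => eq_of_partialProd_eq hm ht' ht le_rfl htw' i i.2
  · obtain ⟨l, hl1, hl2, hl3, hl4⟩ := exists_reflection_list ht (le_refl n)
    rw [partialProd_self, htw] at hl3 hl4
    simp only [Fin.is_lt, true_and] at hl1
    rw [← hl1]
    refine le_antisymm (Nat.sInf_le ⟨l, rfl, hl2, hl3⟩) (le_csInf ⟨_, l, rfl, hl2, hl3⟩ ?_)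
    rintro k ⟨l', rfl, hl', hlw⟩
    have h := finrank_le_finrank_fixSub_prod_add_length l' fun s hs => (hl' s hs).2
    rw [hlw, finrank_fin_fun] at h
    omega

end
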